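/- For every pair of positive integers p and q there exists a function ψ : ℝ^p → ℝ^q that is ℤ^p-periodic (ψ(y + k) = ψ(y) for all k ∈ ℤ^p), has bounded image ψ((0,1]^p), and has the universal null-set property: for all positive integers n, d with d < n and p ≤ n − d ≤ q, and every measurable f : ℝ^p × ℝ^q × ℝ^d → ℝ^{n−d} such that for almost every t ∈ ℝ^d the map (y, ω) ↦ f(y, ω, t) is C¹ with everywhere surjective and Lipschitz partial Jacobian ∂f/∂ω, the set ⋃_{y ∈ ℝ^p} { (f(y, ψ(y), t), t) : t ∈ ℝ^d } has n-dimensional Lebesgue measure zero. -/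

import Mathlib

open MeasureTheory

open Filter Topology

section FactorialGrid

variable {p q : ℕ}

/-- The integer coordinates of the cell of the grid of mesh `1 / N!` containing `y`. -/
noncomputable def gridIndex (N : ℕ) (y : Fin p → ℝ) : Fin p → ℤ := fun i => ⌊y i * (N.factorial : ℝ)⌋

/-- The lower corner of the cell of the grid of mesh `1 / N!` containing `y`. -/
noncomputable def gridPoint (N : ℕ) (y : Fin p → ℝ) : Fin p → ℝ :=
  fun i => (gridIndex N y i : ℝ) / (N.factorial : ℝ)

lemma gridIndex_of_succ (N : ℕ) (y : Fin p → ℝ) (i : Fin p) :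
    gridIndex N y i = gridIndex (N + 1) y i / ((N + 1 : ℕ) : ℤ) := by
  unfold gridIndex
  rw [← Int.floor_div_natCast]
  congr 1
  rw [Nat.factorial_succ]
  push_cast
  field_simp

lemma gridIndex_eq_of_le {N k : ℕ} (hk : k ≤ N) {y y' : Fin p → ℝ}
    (h : gridIndex N y = gridIndex N y') : gridIndex k y = gridIndex k y' := by
  induction N, hk using Nat.le_induction with
  | base => exact h
  | succ N _ ih =>
    refine ih (funext fun i => ?_)
    rw [gridIndex_of_succ N y, gridIndex_of_succ N y', h]

lemma gridPoint_le (N : ℕ) (y : Fin p → ℝ) (i : Fin p) : gridPoint N y i ≤ y i := by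
  have h : (0 : ℝ) < N.factorial := by positivity
  rw [gridPoint, div_le_iff₀ h]
  exact Int.floor_le _

lemma lt_gridPoint_add (N : ℕ) (y : Fin p → ℝ) (i : Fin p) :
    y i < gridPoint N y i + 1 / N.factorial := by
  have h : (0 : ℝ) < N.factorial := by positivity
  rw [gridPoint, ← add_div, lt_div_iff₀ h]
  exact Int.lt_floor_add_one _

lemma norm_sub_gridPoint_le (N : ℕ) (y : Fin p → ℝ) :
    ‖y - gridPoint N y‖ ≤ 1 / N.factorial := by
  refine (pi_norm_le_iff_of_nonneg (by positivity)).2 fun i => ?_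
  rw [Pi.sub_apply, Real.norm_eq_abs, abs_le]
  have h1 := gridPoint_le N y i
  have h2 := lt_gridPoint_add N y i
  have h3 : (0 : ℝ) ≤ 1 / N.factorial := by positivity
  constructor <;> linarith

lemma gridPoint_eq {N : ℕ} {y y' : Fin p → ℝ} (h : gridIndex N y = gridIndex N y') :
    gridPoint N y = gridPoint N y' := by
  unfold gridPoint
  rw [h]

lemma norm_sub_le_of_gridIndex_eq {N : ℕ} {y y' : Fin p → ℝ}
    (h : gridIndex N y = gridIndex N y') : ‖y' - y‖ ≤ 1 / N.factorial := by
  refine (pi_norm_le_iff_of_nonneg (by positivity)).2 fun i => ?_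
  rw [Pi.sub_apply, Real.norm_eq_abs, abs_le]
  have h1 := gridPoint_le N y i
  have h2 := lt_gridPoint_add N y i
  have h3 := gridPoint_le N y' i
  have h4 := lt_gridPoint_add N y' i
  rw [gridPoint_eq h] at h1 h2
  constructor <;> linarith

lemma norm_gridPoint_succ_sub_le (N : ℕ) (y : Fin p → ℝ) :
    ‖gridPoint (N + 1) y - gridPoint N y‖ ≤ 1 / N.factorial := by
  refine (pi_norm_le_iff_of_nonneg (by positivity)).2 fun i => ?_
  have h : gridIndex N (gridPoint (N + 1) y) = gridIndex N y := by
    funext j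
    rw [gridIndex_of_succ N y, gridIndex, ← Int.floor_intCast (R := ℝ) (gridIndex (N + 1) y j),
      ← Int.floor_div_natCast, gridPoint]
    congr 1
    rw [Nat.factorial_succ]
    push_cast
    field_simp
  have h1 := gridPoint_le N (gridPoint (N + 1) y) i
  have h2 := lt_gridPoint_add N (gridPoint (N + 1) y) i
  rw [gridPoint_eq h] at h1 h2
  have h3 : (0 : ℝ) ≤ 1 / N.factorial := by positivity
  rw [Pi.sub_apply, Real.norm_eq_abs, abs_le]
  constructor <;> linarith

lemma gridPoint_add_int (N : ℕ) (y : Fin p → ℝ) (k : Fin p → ℤ) :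
    gridPoint N (y + fun i => (k i : ℝ)) = gridPoint N y + fun i => (k i : ℝ) := by
  funext i
  have h : (y i + k i) * (N.factorial : ℝ)
      = y i * (N.factorial : ℝ) + ((k i * (N.factorial : ℤ) : ℤ) : ℝ) := by
    push_cast
    ring
  simp only [gridPoint, gridIndex, Pi.add_apply, h, Int.floor_add_intCast]
  push_cast
  field_simp

/-- The bound `√k / k!` on the size of the `k`-th term of the series defining `factorialSum`. -/
noncomputable def termBound (k : ℕ) : ℝ := √k / k.factorial

lemma termBound_nonneg (k : ℕ) : 0 ≤ termBound k := by unfold termBound; positivity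

lemma summable_termBound : Summable termBound := by
  refine Summable.of_nonneg_of_le termBound_nonneg (fun k => ?_)
    (Real.summable_pow_div_factorial 2)
  refine div_le_div_of_nonneg_right ?_ (by positivity)
  rw [Real.sqrt_le_left (by positivity)]
  have : k < 2 ^ k := Nat.lt_two_pow_self
  have h : (k : ℝ) ≤ 2 ^ k := by exact_mod_cast this.le
  nlinarith [one_le_pow₀ (n := k) (one_le_two : (1 : ℝ) ≤ 2)]

/-- The tail `∑ j ≥ N, √j / j!`. -/
noncomputable def tailBound (N : ℕ) : ℝ := ∑' j, termBound (j + N)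

lemma tailBound_nonneg (N : ℕ) : 0 ≤ tailBound N := tsum_nonneg fun _ => termBound_nonneg _

lemma hasSum_tailBound (N : ℕ) : HasSum (fun j => termBound (j + N)) (tailBound N) :=
  ((summable_nat_add_iff N).2 summable_termBound).hasSum

lemma termBound_le_tailBound (N : ℕ) : termBound N ≤ tailBound N := by
  simpa [tailBound] using (hasSum_tailBound N).summable.le_tsum 0 fun j _ => termBound_nonneg _

lemma tendsto_tailBound : Tendsto tailBound atTop (𝓝 0) := tendsto_sum_nat_add termBound

lemma factorial_mul_termBound_le {N : ℕ} (hN : 1 ≤ N) (j : ℕ) :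
    N.factorial * termBound (j + (N + 1)) ≤ ((j + 1) * (1 / 2 : ℝ) ^ j) * (1 / √(N + 1)) := by
  have h1 : √((j + (N + 1) : ℕ) : ℝ) ≤ √(N + 1 : ℝ) * (j + 1) := by
    rw [Real.sqrt_le_left (by positivity), mul_pow, Real.sq_sqrt (by positivity)]
    push_cast
    nlinarith [mul_nonneg (Nat.cast_nonneg (α := ℝ) j) (Nat.cast_nonneg (α := ℝ) N),
      mul_nonneg (mul_nonneg (Nat.cast_nonneg (α := ℝ) j) (Nat.cast_nonneg (α := ℝ) N))
        (Nat.cast_nonneg (α := ℝ) j), sq_nonneg (j : ℝ), Nat.cast_nonneg (α := ℝ) j]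
  have h2 : (N.factorial : ℝ) * ((N + 1) * 2 ^ j) ≤ ((j + (N + 1)).factorial : ℝ) := by
    have h3 : N.factorial * (N + 1) ^ (j + 1) ≤ (N + (j + 1)).factorial :=
      Nat.factorial_mul_pow_le_factorial
    have h4 : N.factorial * ((N + 1) * 2 ^ j) ≤ N.factorial * (N + 1) ^ (j + 1) := by
      rw [pow_succ']
      gcongr
      omega
    have h5 : N + (j + 1) = j + (N + 1) := by ring
    rw [h5] at h3
    exact_mod_cast h4.trans h3
  have hs : 0 < √(N + 1 : ℝ) := by positivity
  have hss : √(N + 1 : ℝ) * √(N + 1 : ℝ) = N + 1 := Real.mul_self_sqrt (by positivity)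
  have hf : (0 : ℝ) < N.factorial := by positivity
  calc (N.factorial : ℝ) * termBound (j + (N + 1))
      ≤ N.factorial * ((√(N + 1 : ℝ) * (j + 1)) / (N.factorial * ((N + 1) * 2 ^ j))) := by
        unfold termBound
        gcongr
    _ = ((j + 1) * (1 / 2 : ℝ) ^ j) * (1 / √(N + 1)) := by
        rw [one_div_pow]
        field_simp
        rw [sq, hss]

lemma tendsto_factorial_mul_tailBound :
    Tendsto (fun N : ℕ => (N.factorial : ℝ) * tailBound (N + 1)) atTop (𝓝 0) := by
  have hs : Summable fun j : ℕ => ((j : ℝ) + 1) * (1 / 2 : ℝ) ^ j := by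
    have h1 := summable_pow_mul_geometric_of_norm_lt_one 1
      (r := (1 / 2 : ℝ)) (by norm_num)
    have h2 := summable_geometric_of_lt_one (r := (1 / 2 : ℝ)) (by norm_num) (by norm_num)
    refine (h1.add h2).congr fun j => ?_
    ring
  have hlim : Tendsto (fun N : ℕ => (∑' j : ℕ, ((j : ℝ) + 1) * (1 / 2 : ℝ) ^ j) * (1 / √(N + 1)))
      atTop (𝓝 0) := by
    rw [← mul_zero (∑' j : ℕ, ((j : ℝ) + 1) * (1 / 2 : ℝ) ^ j)]
    refine Tendsto.const_mul _ ?_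
    simp only [one_div]
    exact tendsto_inv_atTop_zero.comp (Real.tendsto_sqrt_atTop.comp
      (tendsto_natCast_atTop_atTop.atTop_add tendsto_const_nhds))
  refine squeeze_zero' (Eventually.of_forall fun N =>
    mul_nonneg (by positivity) (tailBound_nonneg _)) ?_ hlim
  filter_upwards [eventually_ge_atTop 1] with N hN
  rw [tailBound, ← tsum_mul_left, ← tsum_mul_right]
  exact Summable.tsum_le_tsum (factorial_mul_termBound_le hN)
    ((hasSum_tailBound _).summable.mul_left _) (hs.mul_right _)

/-- The function `y ↦ ∑ k, S k (yₖ₊₁ - yₖ)`, where `yₖ` is the lower corner of the cell of mesh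
`1 / k!` containing `y`. -/
noncomputable def factorialSum (S : ℕ → (Fin p → ℝ) →L[ℝ] (Fin q → ℝ)) (y : Fin p → ℝ) :
    Fin q → ℝ :=
  ∑' k, S k (gridPoint (k + 1) y - gridPoint k y)

variable {S : ℕ → (Fin p → ℝ) →L[ℝ] (Fin q → ℝ)}

lemma factorialSum_add_int (y : Fin p → ℝ) (k : Fin p → ℤ) :
    factorialSum S (y + fun i => (k i : ℝ)) = factorialSum S y := by
  simp only [factorialSum, gridPoint_add_int, add_sub_add_right_eq_sub]

lemma norm_factorialSum_term_le (hS : ∀ k, ‖S k‖ ≤ √k) (y : Fin p → ℝ) (k : ℕ) :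
    ‖S k (gridPoint (k + 1) y - gridPoint k y)‖ ≤ termBound k := by
  refine ((S k).le_of_opNorm_le_of_le (hS k) (norm_gridPoint_succ_sub_le k y)).trans_eq ?_
  rw [termBound, mul_one_div]

lemma summable_factorialSum_term (hS : ∀ k, ‖S k‖ ≤ √k) (y : Fin p → ℝ) :
    Summable fun k => S k (gridPoint (k + 1) y - gridPoint k y) :=
  Summable.of_norm_bounded summable_termBound (norm_factorialSum_term_le hS y)

lemma norm_factorialSum_le (hS : ∀ k, ‖S k‖ ≤ √k) (y : Fin p → ℝ) :
    ‖factorialSum S y‖ ≤ tailBound 0 :=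
  tsum_of_norm_bounded (hasSum_tailBound 0) (norm_factorialSum_term_le hS y)

/-- On a cell of mesh `1 / N!` the function `factorialSum S` varies by at most `2 * tailBound N`. -/
lemma norm_factorialSum_sub_le (hS : ∀ k, ‖S k‖ ≤ √k) {N : ℕ} {y y' : Fin p → ℝ}
    (h : gridIndex N y = gridIndex N y') :
    ‖factorialSum S y' - factorialSum S y‖ ≤ 2 * tailBound N := by
  have hs := (summable_factorialSum_term hS y').sub (summable_factorialSum_term hS y)
  rw [factorialSum, factorialSum, ← (summable_factorialSum_term hS y').tsum_sub
    (summable_factorialSum_term hS y), ← hs.sum_add_tsum_nat_add N, Finset.sum_eq_zero, zero_add]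
  · refine tsum_of_norm_bounded ((hasSum_tailBound N).mul_left 2) fun j => ?_
    refine (norm_sub_le _ _).trans ?_
    linarith [norm_factorialSum_term_le hS y (j + N), norm_factorialSum_term_le hS y' (j + N)]
  · intro k hk
    have hk' := Finset.mem_range.1 hk
    rw [gridPoint_eq (gridIndex_eq_of_le hk' h), gridPoint_eq (gridIndex_eq_of_le hk'.le h),
      sub_self]

/-- On a cell of mesh `1 / N!` the function `factorialSum S` is close to being affine with linear
part `S N`. -/
lemma norm_factorialSum_sub_sub_le (hS : ∀ k, ‖S k‖ ≤ √k) {N : ℕ} {y y' : Fin p → ℝ}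
    (h : gridIndex N y = gridIndex N y') :
    ‖factorialSum S y' - factorialSum S y - S N (y' - y)‖ ≤ 4 * tailBound (N + 1) := by
  have hs := (summable_factorialSum_term hS y').sub (summable_factorialSum_term hS y)
  rw [factorialSum, factorialSum, ← (summable_factorialSum_term hS y').tsum_sub
    (summable_factorialSum_term hS y), ← hs.sum_add_tsum_nat_add (N + 1), Finset.sum_range_succ,
    Finset.sum_eq_zero, zero_add]
  · have h1 : ‖∑' j, (S (j + (N + 1)) (gridPoint (j + (N + 1) + 1) y' - gridPoint (j + (N + 1)) y')
        - S (j + (N + 1)) (gridPoint (j + (N + 1) + 1) y - gridPoint (j + (N + 1)) y))‖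
        ≤ 2 * tailBound (N + 1) := by
      refine tsum_of_norm_bounded ((hasSum_tailBound (N + 1)).mul_left 2) fun j => ?_
      refine (norm_sub_le _ _).trans ?_
      linarith [norm_factorialSum_term_le hS y (j + (N + 1)),
        norm_factorialSum_term_le hS y' (j + (N + 1))]
    have h2 : ∀ x : Fin p → ℝ, ‖S N (x - gridPoint (N + 1) x)‖ ≤ tailBound (N + 1) := fun x => by
      refine ((S N).le_of_opNorm_le_of_le (hS N) (norm_sub_gridPoint_le (N + 1) x)).trans ?_
      refine le_trans ?_ (termBound_le_tailBound _)
      rw [mul_one_div, termBound]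
      gcongr
      omega
    rw [gridPoint_eq h]
    set T := ∑' j, (S (j + (N + 1)) (gridPoint (j + (N + 1) + 1) y' - gridPoint (j + (N + 1)) y')
        - S (j + (N + 1)) (gridPoint (j + (N + 1) + 1) y - gridPoint (j + (N + 1)) y))
    have h3 : S N (gridPoint (N + 1) y' - gridPoint N y')
        - S N (gridPoint (N + 1) y - gridPoint N y') + T - S N (y' - y)
        = T - S N (y' - gridPoint (N + 1) y') + S N (y - gridPoint (N + 1) y) := by
      simp only [map_sub]
      abel
    rw [h3]
    refine (norm_add_le _ _).trans ?_
    have := norm_sub_le T (S N (y' - gridPoint (N + 1) y'))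
    linarith [h2 y, h2 y']
  · intro k hk
    have hk' := Finset.mem_range.1 hk
    rw [gridPoint_eq (gridIndex_eq_of_le hk' h), gridPoint_eq (gridIndex_eq_of_le hk'.le h),
      sub_self]

/-- A separable normed space has a dense sequence all of whose members are attained infinitely often
by a sequence of slow growth. -/
lemma exists_seq_frequently_eq_denseRange (E : Type*) [NormedAddCommGroup E]
    [TopologicalSpace.SeparableSpace E] :
    ∃ S D : ℕ → E, DenseRange D ∧ (∀ k, ‖S k‖ ≤ √k) ∧ ∀ j N, ∃ k, N ≤ k ∧ S k = D j := by
  classical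
  obtain ⟨D, hD⟩ := TopologicalSpace.exists_dense_seq E
  refine ⟨fun k => if ‖D k.unpair.1‖ ≤ √k then D k.unpair.1 else 0, D, hD, fun k => ?_,
    fun j N => ?_⟩
  · dsimp only
    split_ifs with h
    · exact h
    · simp
  · obtain ⟨M, hM⟩ := exists_nat_ge (‖D j‖ ^ 2)
    refine ⟨Nat.pair j (max N M), (le_max_left N M).trans (Nat.right_le_pair _ _), ?_⟩
    have h : ‖D j‖ ≤ √(Nat.pair j (max N M) : ℕ) := by
      refine Real.le_sqrt_of_sq_le (hM.trans ?_)
      exact_mod_cast (le_max_right N M).trans (Nat.right_le_pair _ _)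
    simp [h]

end FactorialGrid

section Covering

variable {p m : ℕ}

lemma gridCell_subset_iUnion (N : ℕ) (z : Fin p → ℤ) :
    {y : Fin p → ℝ | gridIndex N y = z} ⊆
      ⋃ j : Fin p → Fin (N + 1),
        {y | gridIndex (N + 1) y = fun i => z i * (N + 1 : ℕ) + (j i : ℕ)} := by
  intro y hy
  have hpos : (0 : ℤ) < (N + 1 : ℕ) := by positivity
  have hlt : ∀ i, (gridIndex (N + 1) y i % (N + 1 : ℕ)).toNat < N + 1 := fun i => by
    have := Int.emod_lt_of_pos (gridIndex (N + 1) y i) hpos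
    omega
  refine Set.mem_iUnion.2 ⟨fun i => ⟨_, hlt i⟩, funext fun i => ?_⟩
  rw [← show gridIndex N y = z from hy, gridIndex_of_succ N y,
    Int.toNat_of_nonneg (Int.emod_nonneg _ hpos.ne')]
  exact (Int.ediv_mul_add_emod _ _).symm

lemma volume_closure_image_gridCell_le (hm : 0 < m) (hpm : p ≤ m)
    (G : (Fin p → ℝ) → (Fin m → ℝ)) {ε : ℝ} (hε : 0 ≤ ε) (hε1 : ε ≤ 1) {M N : ℕ}
    (hNM : N ≤ M) (z : Fin p → ℤ)
    (hz : ∀ y, gridIndex N y = z → ∃ N', N ≤ N' ∧ N' < M ∧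
      ∃ c, G '' {y' | gridIndex N' y' = gridIndex N' y} ⊆
        Metric.closedBall c (ε / (2 * N'.factorial))) :
    volume (closure (G '' {y | gridIndex N y = z})) ≤
      ENNReal.ofReal (ε / (N.factorial : ℝ) ^ p) := by
  induction hNM using Nat.decreasingInduction generalizing z with
  | self =>
    have : {y : Fin p → ℝ | gridIndex M y = z} = ∅ := by
      refine Set.eq_empty_of_forall_notMem fun y hy => ?_
      obtain ⟨N', h1, h2, -⟩ := hz y hy
      omega
    simp [this]
  | of_succ N hN ih =>
    by_cases hgood : ∃ c, G '' {y' | gridIndex N y' = z} ⊆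
        Metric.closedBall c (ε / (2 * N.factorial))
    · obtain ⟨c, hc⟩ := hgood
      have hN1 : (1 : ℝ) ≤ N.factorial := by exact_mod_cast N.factorial_pos
      refine (measure_mono (closure_minimal hc Metric.isClosed_closedBall)).trans ?_
      rw [Real.volume_pi_closedBall _ (by positivity), Fintype.card_fin]
      refine ENNReal.ofReal_le_ofReal ?_
      have h : 2 * (ε / (2 * (N.factorial : ℝ))) = ε / N.factorial := by field_simp
      rw [h, div_pow]
      gcongr
      exact pow_le_of_le_one hε hε1 hm.ne'
    · have hchild : ∀ j : Fin p → Fin (N + 1), volume (closure (G '' {y | gridIndex (N + 1) y =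
          fun i => z i * (N + 1 : ℕ) + (j i : ℕ)})) ≤
          ENNReal.ofReal (ε / ((N + 1).factorial : ℝ) ^ p) := fun j => by
        refine ih _ fun y hy => ?_
        have hyz : gridIndex N y = z := by
          funext i
          rw [gridIndex_of_succ, hy]
          dsimp only
          rw [add_comm, Int.add_mul_ediv_right _ _ (by positivity),
            Int.ediv_eq_zero_of_lt (by positivity) (by exact_mod_cast (j i).2), zero_add]
        obtain ⟨N', h1, h2, h3⟩ := hz y hyz
        refine ⟨N', lt_of_le_of_ne h1 ?_, h2, h3⟩
        rintro rfl
        rw [hyz] at h3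
        exact hgood h3
      have hsub := closure_mono (Set.image_mono (f := G) (gridCell_subset_iUnion N z))
      rw [Set.image_iUnion, closure_iUnion_of_finite] at hsub
      refine (measure_mono hsub).trans <| (measure_iUnion_fintype_le _ _).trans <|
        (Finset.sum_le_sum fun j _ => hchild j).trans_eq ?_
      rw [Finset.sum_const, Finset.card_univ, Fintype.card_fun, Fintype.card_fin, Fintype.card_fin,
        nsmul_eq_mul, ← ENNReal.ofReal_natCast, ← ENNReal.ofReal_mul (by positivity)]
      congr 1
      rw [Nat.factorial_succ]
      push_cast
      rw [mul_pow]
      field_simp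

end Covering

section Slice

variable {p q m : ℕ}

/-- If a `C¹` map has surjective partial derivative in the second variable, then at each point its
derivative can be made to vanish on the graph of a linear map. -/
lemma exists_fderiv_comp_prod_eq_zero {g : (Fin p → ℝ) × (Fin q → ℝ) → (Fin m → ℝ)}
    (hg : Differentiable ℝ g) (a : (Fin p → ℝ) × (Fin q → ℝ))
    (ha : Function.Surjective (fderiv ℝ (fun ω => g (a.1, ω)) a.2)) :
    ∃ S : (Fin p → ℝ) →L[ℝ] (Fin q → ℝ),
      (fderiv ℝ g a).comp ((ContinuousLinearMap.id ℝ (Fin p → ℝ)).prod S) = 0 := by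
  have hT : fderiv ℝ (fun ω => g (a.1, ω)) a.2 =
      (fderiv ℝ g a).comp (ContinuousLinearMap.inr ℝ (Fin p → ℝ) (Fin q → ℝ)) :=
    ((hg a).hasFDerivAt.comp a.2 (hasFDerivAt_prodMk_right a.1 a.2)).fderiv
  rw [hT] at ha
  obtain ⟨R, hR⟩ := LinearMap.exists_rightInverse_of_surjective
    ((fderiv ℝ g a).comp (ContinuousLinearMap.inr ℝ (Fin p → ℝ) (Fin q → ℝ))).toLinearMap
    (LinearMap.range_eq_top.2 ha)
  refine ⟨-((LinearMap.toContinuousLinearMap R).comp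
    ((fderiv ℝ g a).comp (ContinuousLinearMap.inl ℝ (Fin p → ℝ) (Fin q → ℝ)))), ?_⟩
  ext1 v
  have h := LinearMap.congr_fun hR (fderiv ℝ g a (v, 0))
  simp only [LinearMap.comp_apply, ContinuousLinearMap.coe_coe, ContinuousLinearMap.comp_apply,
    ContinuousLinearMap.inr_apply, LinearMap.id_apply] at h
  have h2 : ((v, -(R (fderiv ℝ g a (v, 0)))) : (Fin p → ℝ) × (Fin q → ℝ)) =
      (v, 0) - (0, R (fderiv ℝ g a (v, 0))) := by simp
  have h3 : fderiv ℝ g a (0, R (fderiv ℝ g a (v, 0))) = fderiv ℝ g a (v, 0) := h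
  change fderiv ℝ g a (v, -(R (fderiv ℝ g a (v, 0)))) = 0
  rw [h2, map_sub, h3, sub_self]

lemma norm_sub_le_of_fderiv_comp_prod {g : (Fin p → ℝ) × (Fin q → ℝ) → (Fin m → ℝ)}
    (hg : Differentiable ℝ g) {a a' : (Fin p → ℝ) × (Fin q → ℝ)} {δ ε L : ℝ}
    {S : (Fin p → ℝ) →L[ℝ] (Fin q → ℝ)}
    (hS : ∀ b ∈ Metric.ball a δ,
      ‖(fderiv ℝ g b).comp ((ContinuousLinearMap.id ℝ (Fin p → ℝ)).prod S)‖ ≤ ε)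
    (hL : ∀ b ∈ Metric.ball a δ, ‖fderiv ℝ g b‖ ≤ L)
    (ha' : a' ∈ Metric.ball a δ) (hb : ‖S (a'.1 - a.1)‖ < δ) :
    ‖g a' - g a‖ ≤ ε * ‖a'.1 - a.1‖ + L * ‖a'.2 - a.2 - S (a'.1 - a.1)‖ := by
  set T := (ContinuousLinearMap.id ℝ (Fin p → ℝ)).prod S with hT
  set v := a'.1 - a.1 with hv
  have hδ : 0 < δ := (norm_nonneg _).trans_lt hb
  have hvδ : ‖v‖ < δ := by
    rw [Metric.mem_ball, dist_eq_norm] at ha'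
    exact (norm_fst_le (a' - a)).trans_lt ha'
  have hTv : T v = (v, S v) := rfl
  have hbδ : a + T v ∈ Metric.ball a δ := by
    rw [Metric.mem_ball, dist_eq_norm, add_sub_cancel_left, hTv]
    exact max_lt hvδ hb
  have h1 : ‖g (a + T v) - g a‖ ≤ ε * ‖v‖ := by
    have hconv : Convex ℝ ((fun x => a + T x) ⁻¹' Metric.ball a δ) :=
      ((convex_ball a δ).translate_preimage_right a).linear_preimage T.toLinearMap
    have h := hconv.norm_image_sub_le_of_norm_hasFDerivWithin_le (f := fun x => g (a + T x))
      (f' := fun x => (fderiv ℝ g (a + T x)).comp T) (C := ε) (x := 0) (y := v)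
      (fun x _ => ((hg _).hasFDerivAt.comp x (T.hasFDerivAt.const_add a)).hasFDerivWithinAt)
      (fun x hx => hS _ hx) 
      (by
        change a + T 0 ∈ Metric.ball a δ
        simpa using hδ) hbδ
    simpa using h
  have h2 : ‖g a' - g (a + T v)‖ ≤ L * ‖a' - (a + T v)‖ :=
    (convex_ball a δ).norm_image_sub_le_of_norm_fderiv_le (fun x _ => hg x) hL hbδ ha'
  have h3 : a' - (a + T v) = (0, a'.2 - a.2 - S v) := by
    rw [hTv]
    ext1
    · simp [hv]
    · simp [sub_sub]
  rw [h3, Prod.norm_mk, norm_zero, max_eq_right (norm_nonneg _)] at h2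
  have h4 := norm_sub_le_norm_sub_add_norm_sub (g a') (g (a + T v)) (g a)
  linarith

/-- The image of the graph of `factorialSum S` over a unit cell under a `C¹` map with surjective
partial derivative in the second variable has null closure. -/
lemma volume_closure_image_factorialSum_eq_zero (hm : 0 < m) (hpm : p ≤ m)
    {S : ℕ → (Fin p → ℝ) →L[ℝ] (Fin q → ℝ)} (hS : ∀ k, ‖S k‖ ≤ √k)
    {D : ℕ → (Fin p → ℝ) →L[ℝ] (Fin q → ℝ)} (hD : DenseRange D)
    (hSD : ∀ j N, ∃ k, N ≤ k ∧ S k = D j)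
    {g : (Fin p → ℝ) × (Fin q → ℝ) → (Fin m → ℝ)} (hg : ContDiff ℝ 1 g)
    (hsurj : ∀ a : (Fin p → ℝ) × (Fin q → ℝ),
      Function.Surjective (fderiv ℝ (fun ω => g (a.1, ω)) a.2))
    (z : Fin p → ℤ) :
    volume (closure ((fun y => g (y, factorialSum S y)) '' {y | gridIndex 0 y = z})) = 0 := by
  have hgd : Differentiable ℝ g := hg.differentiable one_ne_zero
  have hg' : Continuous (fderiv ℝ g) := hg.continuous_fderiv one_ne_zero
  set R : ℝ := max (‖fun i => (z i : ℝ)‖ + 1) (tailBound 0) with hR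
  have hgraph : ∀ y : Fin p → ℝ, gridIndex 0 y = z →
      (y, factorialSum S y) ∈ Metric.closedBall (0 : (Fin p → ℝ) × (Fin q → ℝ)) R := fun y hy => by
    rw [mem_closedBall_zero_iff, Prod.norm_mk]
    refine max_le_max ?_ (norm_factorialSum_le hS y)
    have h1 := norm_sub_gridPoint_le 0 y
    have h2 : gridPoint 0 y = fun i => (z i : ℝ) := by
      funext i
      simp [gridPoint, hy]
    rw [h2] at h1
    have h3 := norm_le_norm_add_norm_sub' y fun i => (z i : ℝ)
    simp only [Nat.factorial_zero, Nat.cast_one, div_one] at h1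
    linarith
  obtain ⟨L, hL⟩ := (isCompact_closedBall (0 : (Fin p → ℝ) × (Fin q → ℝ))
    (R + 1)).exists_bound_of_continuousOn hg'.continuousOn
  have hL0 : 0 ≤ max L 0 := le_max_right _ _
  suffices h : ∀ ε : ℝ, 0 < ε → ε ≤ 1 → volume (closure ((fun y => g (y, factorialSum S y)) ''
      {y | gridIndex 0 y = z})) ≤ ENNReal.ofReal ε by
    refine le_antisymm (ge_of_tendsto (x := 𝓝[>] (0 : ℝ)) (f := ENNReal.ofReal) ?_ ?_) zero_le
    · have := (ENNReal.continuous_ofReal.tendsto 0).mono_left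
        (nhdsWithin_le_nhds (s := Set.Ioi (0 : ℝ)))
      simpa using this
    · filter_upwards [Ioc_mem_nhdsGT (zero_lt_one' ℝ)] with ε hε
      exact h ε hε.1 hε.2
  intro ε hε hε1
  let V : ((Fin p → ℝ) →L[ℝ] (Fin q → ℝ)) → Set ((Fin p → ℝ) × (Fin q → ℝ)) := fun A =>
    {a | ‖(fderiv ℝ g a).comp ((ContinuousLinearMap.id ℝ (Fin p → ℝ)).prod A)‖ < ε / 4}
  have hVopen : ∀ A, IsOpen (V A) := fun A =>
    isOpen_lt (hg'.clm_comp continuous_const).norm continuous_const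
  have hcover : Metric.closedBall (0 : (Fin p → ℝ) × (Fin q → ℝ)) R ⊆ ⋃ j, V (D j) := by
    intro a _
    obtain ⟨A, hA⟩ := exists_fderiv_comp_prod_eq_zero hgd a (hsurj a)
    have hprod : ∀ B : (Fin p → ℝ) →L[ℝ] (Fin q → ℝ),
        (ContinuousLinearMap.id ℝ (Fin p → ℝ)).prod B =
          ContinuousLinearMap.inl ℝ (Fin p → ℝ) (Fin q → ℝ) +
            (ContinuousLinearMap.inr ℝ (Fin p → ℝ) (Fin q → ℝ)).comp B := fun B => by
      ext1 v
      simp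
    have hopen : IsOpen {B : (Fin p → ℝ) →L[ℝ] (Fin q → ℝ) | a ∈ V B} := by
      refine isOpen_lt (Continuous.norm ?_) continuous_const
      simp only [hprod]
      fun_prop
    have hAV : a ∈ V A := by
      change ‖_‖ < ε / 4
      rw [hA, norm_zero]
      positivity
    obtain ⟨j, hj⟩ := hD.exists_mem_open hopen ⟨A, hAV⟩
    exact Set.mem_iUnion.2 ⟨j, hj⟩
  obtain ⟨t, ht⟩ := (isCompact_closedBall _ _).elim_finite_subcover _ (fun j => hVopen (D j)) hcover
  obtain ⟨δ, hδ, hball⟩ := lebesgue_number_lemma_of_metric (c := fun j : t => V (D j))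
    (isCompact_closedBall (0 : (Fin p → ℝ) × (Fin q → ℝ)) R) (fun j => hVopen _) 
    (ht.trans (Set.iUnion₂_subset fun j hj => Set.subset_iUnion (fun j : t => V (D j)) ⟨j, hj⟩))
  have hδ1 : 0 < min δ 1 := lt_min hδ one_pos
  have hev1 : ∀ᶠ N in atTop, tailBound N < min δ 1 / 8 :=
    tendsto_tailBound.eventually_lt_const (by positivity)
  have hev2 : ∀ᶠ N : ℕ in atTop, (N.factorial : ℝ) * tailBound (N + 1) <
      ε / 4 / (4 * (max L 0 + 1)) :=
    tendsto_factorial_mul_tailBound.eventually_lt_const (by positivity)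
  have hev3 : ∀ᶠ N : ℕ in atTop, 1 / (N.factorial : ℝ) < min δ 1 := by
    have h := FloorSemiring.tendsto_pow_div_factorial_atTop (1 : ℝ)
    simp only [one_pow] at h
    exact h.eventually_lt_const hδ1
  obtain ⟨N₀, hN₀⟩ := eventually_atTop.1 (hev1.and (hev2.and hev3))
  choose κ hκ hκD using hSD
  have hM : (0 : ℕ) ≤ t.sup (κ · N₀) + 1 := Nat.zero_le _
  refine (volume_closure_image_gridCell_le hm hpm _ hε.le hε1 hM z fun y hy => ?_).trans_eq
    (by simp)
  obtain ⟨⟨j, hjt⟩, hj⟩ := hball _ (hgraph y hy)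
  have hN := hκ j N₀
  refine ⟨κ j N₀, Nat.zero_le _, Nat.lt_succ_of_le (Finset.le_sup (f := (κ · N₀)) hjt),
    g (y, factorialSum S y), ?_⟩
  have hSN := hκD j N₀
  generalize κ j N₀ = N at hN hSN
  obtain ⟨h1, h2, h3⟩ := hN₀ N hN
  have h1' := (hN₀ (N + 1) (hN.trans N.le_succ)).1
  rintro _ ⟨y', hy', rfl⟩
  have hcell : gridIndex N y = gridIndex N y' := (show gridIndex N y' = gridIndex N y from hy').symm
  have hv := norm_sub_le_of_gridIndex_eq hcell
  have hw := norm_factorialSum_sub_le hS hcell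
  have he := norm_factorialSum_sub_sub_le hS hcell
  have hf : (0 : ℝ) < N.factorial := by positivity
  have hsub : Metric.ball (y, factorialSum S y) (min δ 1) ⊆ V (S N) := by
    rw [hSN]
    exact (Metric.ball_subset_ball (min_le_left _ _)).trans hj
  have hSv : ‖S N (y' - y)‖ < min δ 1 := by
    have h4 := norm_sub_le (factorialSum S y' - factorialSum S y)
      (factorialSum S y' - factorialSum S y - S N (y' - y))
    rw [sub_sub_cancel] at h4
    linarith
  have ha' : (y', factorialSum S y') ∈ Metric.ball (y, factorialSum S y) (min δ 1) := by
    rw [mem_ball_iff_norm, Prod.mk_sub_mk, Prod.norm_mk]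
    refine max_lt (hv.trans_lt h3) (hw.trans_lt ?_)
    linarith
  have hmain := norm_sub_le_of_fderiv_comp_prod hgd (L := max L 0) (fun b hb => (hsub hb).le)
    (fun b hb => (hL b ?_).trans (le_max_left _ _)) ha' hSv
  · rw [mem_closedBall_iff_norm]
    refine hmain.trans ?_
    have h5 : max L 0 * ‖factorialSum S y' - factorialSum S y - S N (y' - y)‖ ≤
        (max L 0 + 1) * (4 * tailBound (N + 1)) := by
      gcongr
      linarith
    rw [lt_div_iff₀ (by positivity)] at h2
    calc ε / 4 * ‖y' - y‖ + max L 0 * ‖factorialSum S y' - factorialSum S y - S N (y' - y)‖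
        ≤ ε / 4 * (1 / N.factorial) + (max L 0 + 1) * (4 * tailBound (N + 1)) := by gcongr
      _ = (ε / 4 + N.factorial * tailBound (N + 1) * (4 * (max L 0 + 1))) / N.factorial := by
        field_simp
      _ ≤ (ε / 4 + ε / 4) / N.factorial := by gcongr
      _ = ε / (2 * N.factorial) := by
        field_simp
        ring
  · have h6 := hgraph y hy
    rw [mem_closedBall_zero_iff] at h6 ⊢
    rw [mem_ball_iff_norm] at hb
    have h7 := norm_le_norm_add_norm_sub' b (y, factorialSum S y)
    linarith [min_le_right δ 1]

end Slice

section Fubini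

/-- A measurable family of maps, almost every member of which is continuous and sends `A` to a set
with null closure, sweeps out a null set. -/
lemma volume_sweep_eq_zero {α X T : Type*} [MeasurableSpace α] [TopologicalSpace α]
    [TopologicalSpace.PseudoMetrizableSpace α] [SecondCountableTopology α]
    [PseudoMetricSpace X] [MeasureSpace X] [OpensMeasurableSpace X] [SecondCountableTopology X]
    [MeasureSpace T] [SFinite (volume : Measure X)] [SFinite (volume : Measure T)]
    {F : α → T → X} (hF : Measurable fun x : α × T => F x.1 x.2) {A : Set α}
    (hae : ∀ᵐ t : T, Continuous (fun a => F a t) ∧ volume (closure ((fun a => F a t) '' A)) = 0) :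
    volume {xt : X × T | ∃ a ∈ A, ∃ t, xt = (F a t, t)} = 0 := by
  obtain ⟨C, hCA, hC, hAC⟩ :=
    (TopologicalSpace.IsSeparable.of_separableSpace A).exists_countable_dense_subset
  let E : Set (T × X) := ⋂ k : ℕ, ⋃ a ∈ C, {tx | dist (F a tx.1) tx.2 < 1 / (k + 1)}
  have hE : MeasurableSet E := by
    refine MeasurableSet.iInter fun k => MeasurableSet.biUnion hC fun a _ => ?_
    have h1 : Measurable fun tx : T × X => F a tx.1 :=
      hF.comp (measurable_const.prodMk measurable_fst)
    exact measurableSet_lt (h1.dist measurable_snd) measurable_const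
  have hslice : ∀ t, Prod.mk t ⁻¹' E ⊆ closure ((fun a => F a t) '' A) := by
    intro t x hx
    rw [Metric.mem_closure_iff]
    intro ε hε
    obtain ⟨k, hk⟩ := exists_nat_one_div_lt hε
    have hxk := Set.mem_iInter.1 hx k
    simp only [Set.mem_iUnion] at hxk
    obtain ⟨a, haC, ha⟩ := hxk
    refine ⟨_, ⟨a, hCA haC, rfl⟩, ?_⟩
    rw [dist_comm]
    exact lt_trans ha hk
  have hE0 : (volume : Measure (X × T)) (Prod.swap ⁻¹' E) = 0 := by
    have h := (Measure.measurePreserving_swap (μ := (volume : Measure X))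
      (ν := (volume : Measure T))).measure_preimage hE.nullMeasurableSet
    refine h.trans ((Measure.measure_prod_null hE).2 ?_)
    filter_upwards [hae] with t ht
    exact measure_mono_null (hslice t) ht.2
  have hgood : ∀ᵐ xt : X × T, Continuous (fun a => F a xt.2) :=
    Measure.quasiMeasurePreserving_snd.ae (hae.mono fun _ h => h.1)
  refine measure_mono_null ?_ (measure_union_null hE0 hgood)
  rintro _ ⟨a, ha, t, rfl⟩
  by_cases ht : Continuous fun a => F a t
  · refine Or.inl (Set.mem_iInter.2 fun k => ?_)
    have hmem : F a t ∈ closure ((fun a => F a t) '' C) :=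
      image_closure_subset_closure_image ht ⟨a, hAC ha, rfl⟩
    obtain ⟨_, ⟨b, hb, rfl⟩, hlt⟩ := Metric.mem_closure_iff.1 hmem (1 / (k + 1)) (by positivity)
    rw [dist_comm] at hlt
    exact Set.mem_iUnion₂.2 ⟨b, hb, hlt⟩
  · exact Or.inr ht

end Fubini

/-- For every `p, q` there is a `ψ : ℝ^p → ℝ^q` which is `ℤ^p`-periodic, has bounded image
`ψ((0,1]^p)`, and has the universal null-set property: for all `n, d` with `d < n` and
`p ≤ n - d ≤ q`, and every measurable `f : ℝ^p × ℝ^q × ℝ^d → ℝ^{n-d}` such that for a.e.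
`t` the map `(y, ω) ↦ f y ω t` is `C¹` with everywhere surjective and Lipschitz partial
Jacobian `∂f/∂ω`, the set `⋃_y { (f y (ψ y) t, t) : t }` is Lebesgue null. -/
theorem universal_null_packing_periodic_bounded (p q : ℕ) (hp : 0 < p) (hq : 0 < q) :
    ∃ ψ : (Fin p → ℝ) → (Fin q → ℝ),
      (∀ (y : Fin p → ℝ) (k : Fin p → ℤ), ψ (y + fun i => (k i : ℝ)) = ψ y) ∧
      Bornology.IsBounded (ψ '' (Set.univ.pi fun _ : Fin p => Set.Ioc (0 : ℝ) 1)) ∧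
      (∀ n d : ℕ, 0 < n → 0 < d → d < n → p ≤ n - d → n - d ≤ q →
        ∀ f : (Fin p → ℝ) → (Fin q → ℝ) → (Fin d → ℝ) → (Fin (n - d) → ℝ),
          Measurable (fun x : ((Fin p → ℝ) × (Fin q → ℝ)) × (Fin d → ℝ) =>
            f x.1.1 x.1.2 x.2) →
          (∀ᵐ t : Fin d → ℝ,
            ContDiff ℝ 1 (fun yω : (Fin p → ℝ) × (Fin q → ℝ) => f yω.1 yω.2 t) ∧
            (∀ (y : Fin p → ℝ) (ω : Fin q → ℝ),
              Function.Surjective (fderiv ℝ (fun ω' : Fin q → ℝ => f y ω' t) ω)) ∧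
            (∃ K : NNReal, LipschitzWith K
              (fun yω : (Fin p → ℝ) × (Fin q → ℝ) =>
                fderiv ℝ (fun ω' : Fin q → ℝ => f yω.1 ω' t) yω.2))) →
          volume {xt : (Fin (n - d) → ℝ) × (Fin d → ℝ) |
            ∃ (y : Fin p → ℝ) (t : Fin d → ℝ), xt = (f y (ψ y) t, t)} = 0) := by
  obtain ⟨S, D, hD, hS, hSD⟩ :=
    exists_seq_frequently_eq_denseRange ((Fin p → ℝ) →L[ℝ] (Fin q → ℝ))
  refine ⟨factorialSum S, factorialSum_add_int, ?_, ?_⟩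
  · refine isBounded_iff_forall_norm_le.2 ⟨tailBound 0, ?_⟩
    rintro _ ⟨y, -, rfl⟩
    exact norm_factorialSum_le hS y
  · intro n d _ _ hdn hpn _ f hf hae
    have hcell : ∀ z : Fin p → ℤ, volume {xt : (Fin (n - d) → ℝ) × (Fin d → ℝ) |
        ∃ a ∈ (fun y => (y, factorialSum S y)) '' {y | gridIndex 0 y = z}, ∃ t,
          xt = (f a.1 a.2 t, t)} = 0 := fun z => by
      refine volume_sweep_eq_zero (F := fun a : (Fin p → ℝ) × (Fin q → ℝ) => f a.1 a.2) hf ?_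
      filter_upwards [hae] with t ht
      refine ⟨ht.1.continuous, ?_⟩
      rw [Set.image_image]
      exact volume_closure_image_factorialSum_eq_zero (Nat.sub_pos_of_lt hdn) hpn hS hD hSD ht.1
        (fun a => ht.2.1 a.1 a.2) z
    refine measure_mono_null ?_ (measure_iUnion_null hcell)
    rintro _ ⟨y, t, rfl⟩
    exact Set.mem_iUnion.2 ⟨gridIndex 0 y, _, ⟨y, rfl, rfl⟩, t, rfl⟩
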